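/- arXiv:2211.03168 — 2 statements merged into one kernel-verified Lean document; each statement's English description precedes it below -/
import Mathlib

section
/- For every positive integer $k$, there exists a hollow affine $(k-1)$-crystal $C \in \mathcal{T}^{\frac{k^2+k}{2} \cdot \mathbf{1}_k}(\mathbb{Z})$: a $k$-dimensional cubical integer tensor of width $(k^2+k)/2$ whose entries sum to $1$, whose projections onto all strictly increasing $(k-1)$-tuples of modes coincide, and all of whose nonzero entries have pairwise distinct coordinates. -/
/-- The projection of a cubical tensor `C` onto the modes indexed by `i`. -/
def cproj {q k n : ℕ} (C : (Fin q → Fin n) → ℤ) (i : Fin k → Fin q) :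
    (Fin k → Fin n) → ℤ :=
  fun a => ∑ b : Fin q → Fin n, if (fun t => b (i t)) = a then C b else 0

/-- overwrite -/
noncomputable def gmap {k : ℕ} (m : ℕ) (S : Finset (Fin (k+1))) (i0 : Fin (k+1)) (w : Fin k → ℕ) :
    Fin (k+1) → ℕ :=
  fun t => if t ∈ S then m + t else (i0.insertNth (α := fun _ => ℕ) 0 w) t

def Crys {k : ℕ} (E : (Fin k → ℕ) →₀ ℤ) : Prop :=
  ∀ (r : ℕ) (i j : Fin r → Fin k), r + 1 = k → StrictMono i → StrictMono j →
    E.mapDomain (fun w => w ∘ i) = E.mapDomain (fun w => w ∘ j)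

lemma succAbove_swap {k : ℕ} (a b : Fin (k+2)) (j j' : Fin (k+1)) (h : a.succAbove j = b)
    (h' : b.succAbove j' = a) (c : Fin k) :
    b.succAbove (j'.succAbove c) = a.succAbove (j.succAbove c) := by
  subst h
  simp only [Fin.succAbove, Fin.ext_iff, Fin.lt_def] at *
  split_ifs at * <;> simp_all <;> omega

lemma gmap_indep {k : ℕ} (m : ℕ) (E : (Fin k → ℕ) →₀ ℤ) (hE : Crys E)
    (S : Finset (Fin (k+1))) (a b : Fin (k+1)) (ha : a ∈ S) (hb : b ∈ S) :
    E.mapDomain (gmap m S a) = E.mapDomain (gmap m S b) := by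
  by_cases hab : a = b
  · rw [hab]
  obtain ⟨j, hj⟩ := Fin.exists_succAbove_eq (Ne.symm hab)
  obtain ⟨j', hj'⟩ := Fin.exists_succAbove_eq hab
  cases k with
  | zero => exact j.elim0
  | succ k =>
    have hc := hE k j.succAbove j'.succAbove rfl (Fin.strictMono_succAbove _)
      (Fin.strictMono_succAbove _)
    let G : (Fin k → ℕ) → (Fin (k+2) → ℕ) :=
      fun u => gmap m S a (j.insertNth (α := fun _ => ℕ) 0 u)
    have h1 : gmap m S a = G ∘ (fun w => w ∘ j.succAbove) := by
      funext w t
      simp only [G, gmap, Function.comp]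
      split_ifs with ht
      · rfl
      · have hta : t ≠ a := fun h => ht (h ▸ ha)
        obtain ⟨x, rfl⟩ := Fin.exists_succAbove_eq hta
        have hx : x ≠ j := fun h => ht (by rw [h, hj]; exact hb)
        obtain ⟨c, rfl⟩ := Fin.exists_succAbove_eq hx
        simp
    have h2 : gmap m S b = G ∘ (fun w => w ∘ j'.succAbove) := by
      funext w t
      simp only [G, gmap, Function.comp]
      split_ifs with ht
      · rfl
      · have hta : t ≠ a := fun h => ht (h ▸ ha)
        obtain ⟨x, rfl⟩ := Fin.exists_succAbove_eq hta
        have hx : x ≠ j := fun h => ht (by rw [h, hj]; exact hb)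
        obtain ⟨c, rfl⟩ := Fin.exists_succAbove_eq hx
        rw [← succAbove_swap a b j j' hj hj' c, Fin.insertNth_apply_succAbove,
          succAbove_swap a b j j' hj hj' c, Fin.insertNth_apply_succAbove,
          Fin.insertNth_apply_succAbove]
        rfl
    rw [h1, h2, Finsupp.mapDomain_comp, Finsupp.mapDomain_comp, hc]

open Classical in
noncomputable def pick {k : ℕ} (S : Finset (Fin (k+1))) : Fin (k+1) :=
  if h : S.Nonempty then h.choose else 0

lemma pick_mem {k : ℕ} (S : Finset (Fin (k+1))) (h : S.Nonempty) : pick S ∈ S := by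
  unfold pick; rw [dif_pos h]; exact h.choose_spec

noncomputable def Dt {k : ℕ} (m : ℕ) (E : (Fin k → ℕ) →₀ ℤ) : (Fin (k+1) → ℕ) →₀ ℤ :=
  ∑ S ∈ (Finset.univ : Finset (Finset (Fin (k+1)))).filter (fun S => S.Nonempty),
    ((-1 : ℤ) ^ (S.card + 1)) • E.mapDomain (gmap m S (pick S))

lemma Dt_face {k : ℕ} (m : ℕ) (E : (Fin k → ℕ) →₀ ℤ) (hE : Crys E) (i : Fin (k+1)) :
    (Dt m E).mapDomain (fun w => w ∘ i.succAbove) = E := by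
  set T : Finset (Fin (k+1)) → ((Fin k → ℕ) →₀ ℤ) := fun S =>
    (E.mapDomain (gmap m S (pick S))).mapDomain (fun w => w ∘ i.succAbove) with hT
  have hTa : ∀ S, ∀ a ∈ S, T S = E.mapDomain (fun w => gmap m S a w ∘ i.succAbove) := by
    intro S a ha
    simp only [hT]
    rw [gmap_indep m E hE S (pick S) a (pick_mem S ⟨a, ha⟩) ha, ← Finsupp.mapDomain_comp]
    rfl
  have hins : ∀ S : Finset (Fin (k+1)), S.Nonempty → T (insert i S) = T S := by
    rintro S ⟨a, ha⟩
    rw [hTa S a ha, hTa (insert i S) a (Finset.mem_insert_of_mem ha)]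
    congr 1
    funext w t
    simp [gmap]
  have hsing : T {i} = E := by
    rw [hTa {i} i (by simp)]
    have : (fun w => gmap m {i} i w ∘ i.succAbove) = id := by
      funext w t
      simp [gmap]
    rw [this, Finsupp.mapDomain_id]
  have h0 : (Dt m E).mapDomain (fun w => w ∘ i.succAbove) =
      ∑ S ∈ (Finset.univ : Finset (Finset (Fin (k+1)))).filter (fun S => S.Nonempty),
        ((-1 : ℤ) ^ (S.card + 1)) • T S := by
    unfold Dt
    rw [Finsupp.mapDomain_finsetSum]
    refine Finset.sum_congr rfl fun S _ => ?_
    rw [Finsupp.mapDomain_smul]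
  rw [h0, ← Finset.add_sum_erase _ _ (a := {i}) (by simp), hsing]
  simp only [Finset.card_singleton]
  rw [Finset.sum_involution (fun S _ => if i ∈ S then S.erase i else insert i S)]
  · simp
  · intro S hS
    simp only [Finset.mem_erase, Finset.mem_filter, Finset.mem_univ, true_and] at hS
    split_ifs with hi
    · have hne : (S.erase i).Nonempty := by
        rw [Finset.nonempty_iff_ne_empty]
        intro h
        rcases (Finset.erase_eq_empty_iff S i).1 h with h | h
        · simp [h] at hi
        · exact hS.1 h
      have h2 := hins (S.erase i) hne
      rw [Finset.insert_erase hi] at h2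
      rw [h2, ← Finset.card_erase_add_one hi, pow_succ _ ((S.erase i).card + 1)]
      simp
    · rw [hins S hS.2, Finset.card_insert_of_notMem hi, pow_succ _ (S.card + 1)]
      simp
  · intro S hS _
    split_ifs with hi
    · intro h; rw [← h] at hi; simp at hi
    · intro h; apply hi; rw [← h]; simp
  · intro S hS
    simp only [Finset.mem_erase, Finset.mem_filter, Finset.mem_univ, true_and] at hS ⊢
    split_ifs with hi
    · refine ⟨fun h => ?_, ?_⟩
      · have : i ∈ S.erase i := by rw [h]; simp
        simp at this
      · rw [Finset.nonempty_iff_ne_empty]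
        intro h
        rcases (Finset.erase_eq_empty_iff S i).1 h with h | h
        · simp [h] at hi
        · exact hS.1 h
    · refine ⟨fun h => ?_, by simp⟩
      obtain ⟨a, ha⟩ := hS.2
      have : a ∈ insert i S := Finset.mem_insert_of_mem ha
      rw [h, Finset.mem_singleton] at this
      exact hi (this ▸ ha)
  · intro S hS
    by_cases hi : i ∈ S
    · simp [hi]
    · simp [hi]

lemma strictMono_eq_succAbove {k : ℕ} (f : Fin k → Fin (k+1)) (hf : StrictMono f) :
    ∃ i : Fin (k+1), f = i.succAbove := by
  have : ∃ i, ∀ t, f t ≠ i := by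
    by_contra! h
    have := Fintype.card_le_of_surjective f h
    simp at this
  obtain ⟨i, hi⟩ := this
  refine ⟨i, ?_⟩
  choose g hg using fun t => Fin.exists_succAbove_eq (hi t)
  have hgm : StrictMono g := by
    intro a b hab
    have := hf hab
    rw [← hg a, ← hg b] at this
    exact (Fin.strictMono_succAbove i).lt_iff_lt.1 this
  have hgid : g = id := by
    have h := Subsingleton.elim
      (StrictMono.orderIsoOfSurjective g hgm (Finite.surjective_of_injective hgm.injective))
      (OrderIso.refl _)
    funext t
    exact congrArg (fun e : Fin k ≃o Fin k => e t) h
  funext t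
  rw [← hg t, hgid]; rfl

lemma Dt_supp {k : ℕ} (m : ℕ) (E : (Fin k → ℕ) →₀ ℤ)
    (h : ∀ w ∈ E.support, Function.Injective w ∧ ∀ t, w t < m) :
    ∀ w ∈ (Dt m E).support, Function.Injective w ∧ ∀ t, w t < m + (k + 1) := by
  classical
  intro w hw
  unfold Dt at hw
  have hw1 := Finsupp.support_finsetSum hw
  rw [Finset.mem_biUnion] at hw1
  obtain ⟨S, hS, hw2⟩ := hw1
  have hw3 := Finsupp.mapDomain_support (Finsupp.support_smul hw2)
  rw [Finset.mem_image] at hw3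
  obtain ⟨v, hv, rfl⟩ := hw3
  obtain ⟨hinj, hlt⟩ := h v hv
  have hp := pick_mem S (Finset.mem_filter.1 hS).2
  have key : ∀ t, t ∉ S → ∃ c, t = (pick S).succAbove c ∧ gmap m S (pick S) v t = v c := by
    intro t ht
    obtain ⟨c, hc⟩ := Fin.exists_succAbove_eq (x := t) (y := pick S) (fun h => ht (h ▸ hp))
    refine ⟨c, hc.symm, ?_⟩
    unfold gmap
    rw [if_neg ht, ← hc, Fin.insertNth_apply_succAbove]
  have key2 : ∀ t, t ∈ S → gmap m S (pick S) v t = m + t := by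
    intro t ht; simp [gmap, ht]
  constructor
  · intro s t hst
    by_cases hs : s ∈ S <;> by_cases ht : t ∈ S
    · rw [key2 s hs, key2 t ht] at hst
      exact Fin.ext (by omega)
    · obtain ⟨c, _, hc⟩ := key t ht
      rw [key2 s hs, hc] at hst
      have := hlt c; omega
    · obtain ⟨c, _, hc⟩ := key s hs
      rw [key2 t ht, hc] at hst
      have := hlt c; omega
    · obtain ⟨c, h1, hc⟩ := key s hs
      obtain ⟨d, h2, hd⟩ := key t ht
      rw [hc, hd] at hst
      rw [h1, h2, hinj hst]
  · intro t
    by_cases ht : t ∈ S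
    · rw [key2 t ht]; have := t.2; omega
    · obtain ⟨c, _, hc⟩ := key t ht
      rw [hc]; have := hlt c; omega

lemma exists_crys (k : ℕ) : ∃ E : (Fin k → ℕ) →₀ ℤ,
    E.mapDomain (fun _ => ()) = Finsupp.single () 1 ∧ Crys E ∧
    ∀ w ∈ E.support, Function.Injective w ∧ ∀ t, w t < (k ^ 2 + k) / 2 := by
  induction k with
  | zero =>
    refine ⟨Finsupp.single (fun t => t.elim0) 1, by simp, ?_, ?_⟩
    · intro r i j h; omega
    · intro w _
      exact ⟨fun a => a.elim0, fun a => a.elim0⟩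
  | succ k ih =>
    obtain ⟨E, h1, h2, h3⟩ := ih
    refine ⟨Dt ((k^2+k)/2) E, ?_, ?_, ?_⟩
    · rw [← h1]
      conv_rhs => rw [← Dt_face ((k^2+k)/2) E h2 0]
      rw [← Finsupp.mapDomain_comp]
      try rfl
    · intro r i j h hi hj
      obtain rfl : r = k := by omega
      obtain ⟨a, rfl⟩ := strictMono_eq_succAbove i hi
      obtain ⟨b, rfl⟩ := strictMono_eq_succAbove j hj
      rw [Dt_face _ E h2, Dt_face _ E h2]
    · have : ((k+1)^2+(k+1))/2 = (k^2+k)/2 + (k+1) := by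
        have : (k+1)^2+(k+1) = (k^2+k) + (k+1)*2 := by ring
        rw [this, Nat.add_mul_div_right _ _ (by norm_num)]
      rw [this]
      exact Dt_supp _ E h3

lemma sum_conv {k n : ℕ} (E : (Fin k → ℕ) →₀ ℤ)
    (h : ∀ w ∈ E.support, ∀ t, w t < n) (p : (Fin k → ℕ) → ℤ) :
    ∑ b : Fin k → Fin n, p (fun t => (b t : ℕ)) * E (fun t => (b t : ℕ)) =
      E.sum (fun w c => p w * c) := by
  classical
  have hinj : Function.Injective (fun (b : Fin k → Fin n) (t : Fin k) => (b t : ℕ)) := by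
    intro a b hab
    funext t
    exact Fin.ext (congrFun hab t)
  rw [Finsupp.sum, ← Finset.sum_image (s := Finset.univ)
    (g := fun (b : Fin k → Fin n) (t : Fin k) => (b t : ℕ)) (f := fun w => p w * E w)
    (fun a _ b _ hab => hinj hab)]
  symm
  apply Finset.sum_subset
  · intro w hw
    rw [Finset.mem_image]
    exact ⟨fun t => ⟨w t, h w hw t⟩, Finset.mem_univ _, rfl⟩
  · intro w _ hw
    rw [Finsupp.notMem_support_iff.1 hw, mul_zero]

lemma mapDomain_apply_sum {α β : Type*} [DecidableEq β] (E : α →₀ ℤ) (f : α → β) (y : β) :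
    E.mapDomain f y = E.sum (fun w c => (if f w = y then 1 else 0) * c) := by
  rw [Finsupp.mapDomain, Finsupp.sum_apply]
  refine Finset.sum_congr rfl fun w _ => ?_
  simp [Finsupp.single_apply]

/-- For every `k ≥ 1` there is a hollow affine `(k-1)`-crystal of dimension `k`
and width `(k² + k)/2`. -/
theorem stmt_13 (k : ℕ) (hk : 0 < k) :
    ∃ C : (Fin k → Fin ((k ^ 2 + k) / 2)) → ℤ,
      (∑ b, C b) = 1 ∧
      (∀ i j : Fin (k - 1) → Fin k, StrictMono i → StrictMono j →
        cproj C i = cproj C j) ∧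
      (∀ b, ¬ Function.Injective b → C b = 0) := by
  obtain ⟨E, h1, h2, h3⟩ := exists_crys k
  have h4 := fun w hw => (h3 w hw).2
  refine ⟨fun b => E (fun t => (b t : ℕ)), ?_, ?_, ?_⟩
  · have := sum_conv E h4 (fun _ => 1)
    simp only [one_mul] at this
    rw [this]
    have h5 := mapDomain_apply_sum E (fun _ => ()) ()
    rw [h1] at h5
    simpa using h5.symm
  · intro i j hi hj
    have key : ∀ (i : Fin (k-1) → Fin k) a,
        cproj (fun b : Fin k → Fin ((k ^ 2 + k) / 2) => E (fun t => (b t : ℕ))) i a =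
        E.mapDomain (fun w => w ∘ i) (fun t => (a t : ℕ)) := by
      intro i a
      rw [mapDomain_apply_sum, ← sum_conv E h4
        (fun w => if w ∘ i = (fun t => (a t : ℕ)) then 1 else 0)]
      unfold cproj
      refine Finset.sum_congr rfl fun b _ => ?_
      have : ((fun t => b (i t)) = a) ↔
          ((fun t => (b t : ℕ)) ∘ i = (fun t => (a t : ℕ))) := by
        simp [funext_iff, Fin.ext_iff]
      simp only [this]
      simp
    funext a
    rw [key, key, h2 (k-1) i j (by omega) hi hj]
  · intro b hb
    by_contra hne
    apply hb
    have := (h3 _ (Finsupp.mem_support_iff.2 hne)).1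
    intro s t hst
    exact this (by simp [hst])
end

section
/- For all positive integers $k \le q$, there exists an affine $k$-crystal $C \in \mathcal{T}^{\frac{k^2+k}{2} \cdot \mathbf{1}_q}(\mathbb{Z})$ whose $k$-shadow is hollow: a $q$-dimensional cubical integer tensor of width $(k^2+k)/2$ whose entries sum to $1$, whose projections onto all strictly increasing $k$-tuples of modes coincide, and whose common $k$-dimensional projection has all nonzero entries at positions with pairwise distinct coordinates. -/
/-- Inclusion-exclusion operator on word functions. -/
def FF (z : ℕ → ℕ) (T : List ℕ → ℤ) : List ℕ → List ℕ → ℕ → ℤ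
  | u, [], _ => T u
  | u, a :: w, i => FF z T (u ++ [a]) w (i+1) - (if a = z i then FF z T u w (i+1) else 0)

def Coh (T : List ℕ → ℤ) (N m : ℕ) : Prop :=
  ∀ l₁ l₂ : List ℕ, l₁.length + l₂.length < m →
    ∑ a ∈ Finset.range N, T (l₁ ++ a :: l₂) = T (l₁ ++ l₂)

def Supp (T : List ℕ → ℤ) (N : ℕ) : Prop := ∀ l, T l ≠ 0 → ∀ a ∈ l, a < N

lemma FF_sum1 (z : ℕ → ℕ) (T E : List ℕ → ℤ) (N m : ℕ)
    (hE : ∀ l, l.length < m → E l = 0)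
    (hT : ∀ l₁ l₂ : List ℕ, l₁.length + l₂.length ≤ m →
      ∑ a ∈ Finset.range N, T (l₁ ++ a :: l₂) = T (l₁ ++ l₂) - E (l₁ ++ l₂)) :
    ∀ (w u v : List ℕ) (i : ℕ), u.length + v.length + w.length ≤ m →
      ∑ a ∈ Finset.range N, FF z T (u ++ a :: v) w i = FF z T (u ++ v) w i - E (u ++ v ++ w) := by
  intro w
  induction w with
  | nil => 
    intro u v i h
    simp only [FF, List.append_nil]
    exact hT u v (by simpa using h)
  | cons b w ih =>
    intro u v i h
    simp only [List.length_cons] at h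
    have h1 := ih u (v ++ [b]) (i+1) (by simp; omega)
    have h2 := ih u v (i+1) (by omega)
    rw [hE (u ++ v ++ w) (by simp; omega)] at h2
    simp only [FF, Finset.sum_sub_distrib]
    simp only [List.append_assoc, List.cons_append, List.nil_append] at h1 h2 ⊢
    rw [h1]
    split_ifs
    · rw [h2]; ring
    · simp

lemma FF_sum2 (z : ℕ → ℕ) (T E : List ℕ → ℤ) (N m : ℕ)
    (hz : ∀ i, z i < N)
    (hE : ∀ l, l.length < m → E l = 0)
    (hT : ∀ l₁ l₂ : List ℕ, l₁.length + l₂.length ≤ m →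
      ∑ a ∈ Finset.range N, T (l₁ ++ a :: l₂) = T (l₁ ++ l₂) - E (l₁ ++ l₂)) :
    ∀ (w v u : List ℕ) (i : ℕ), u.length + w.length + v.length ≤ m →
      ∑ a ∈ Finset.range N, FF z T u (w ++ a :: v) i = - E (u ++ w ++ v) := by
  intro w
  induction w with
  | nil => 
    intro v u i h
    have h1 := FF_sum1 z T E N m hE hT v u [] (i+1) (by simpa using h)
    simp only [List.nil_append, FF, Finset.sum_sub_distrib, List.append_nil] at h1 ⊢
    rw [h1, Finset.sum_ite_eq']
    simp [hz]
  | cons b w ih =>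
    intro v u i h
    simp only [List.length_cons] at h
    have h1 := ih v (u ++ [b]) (i+1) (by simp; omega)
    have h2 := ih v u (i+1) (by omega)
    rw [hE (u ++ w ++ v) (by simp; omega)] at h2
    simp only [List.cons_append, FF, Finset.sum_sub_distrib]
    rw [h1]
    split_ifs
    · rw [h2]; simp
    · simp

lemma FF_supp (z : ℕ → ℕ) (T : List ℕ → ℤ) (N : ℕ) (hz : ∀ i, z i < N) (hT : Supp T N) :
    ∀ (w u : List ℕ) (i : ℕ), FF z T u w i ≠ 0 → (∀ a ∈ u, a < N) ∧ ∀ a ∈ w, a < N := by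
  intro w
  induction w with
  | nil => intro u i h; exact ⟨hT u h, by simp⟩
  | cons b w ih =>
    intro u i h
    simp only [FF] at h
    by_cases h1 : FF z T (u ++ [b]) w (i+1) = 0
    · rw [h1] at h
      split_ifs at h with hb
      · have := ih u (i+1) (by simpa using h)
        refine ⟨this.1, ?_⟩
        intro a ha
        rcases List.mem_cons.1 ha with rfl | ha
        · rw [hb]; exact hz i
        · exact this.2 a ha
      · simp at h
    · have := ih _ _ h1
      simp only [List.mem_append, List.mem_cons, List.not_mem_nil, or_false] at this ⊢
      grind

lemma FF_nodup (z : ℕ → ℕ) (T : List ℕ → ℤ) (n k : ℕ) (hz : ∀ i, i ≤ k → z i = n + i)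
    (hT : Supp T n) (hT' : ∀ l, T l ≠ 0 → l.Nodup) :
    ∀ (w u : List ℕ) (i : ℕ), i + w.length ≤ k + 1 → FF z T u w i ≠ 0 →
      (u.Nodup ∧ ∀ a ∈ u, a < n) ∧ w.Nodup ∧ (∀ a ∈ w, a ∉ u ∧ (a < n ∨ n + i ≤ a)) := by
  intro w
  induction w with
  | nil => intro u i _ h; exact ⟨⟨hT' u h, hT u h⟩, by simp⟩
  | cons b w ih =>
    intro u i hi h
    simp only [List.length_cons] at hi
    simp only [FF] at h
    by_cases h1 : FF z T (u ++ [b]) w (i+1) = 0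
    · rw [h1] at h
      split_ifs at h with hb
      · obtain ⟨⟨h2, h3⟩, h4, h5⟩ := ih u (i+1) (by omega) (by simpa using h)
        rw [hz i (by omega)] at hb
        refine ⟨⟨h2, h3⟩, ?_, ?_⟩
        · rw [List.nodup_cons]
          refine ⟨fun hm => ?_, h4⟩
          have := (h5 b hm).2
          omega
        · intro a ha
          rcases List.mem_cons.1 ha with rfl | ha
          · refine ⟨fun hm => ?_, by omega⟩
            have := h3 _ hm
            omega
          · have := h5 a ha
            exact ⟨this.1, by omega⟩
      · simp at h
    · obtain ⟨⟨h2, h3⟩, h4, h5⟩ := ih _ _ (by omega) h1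
      rw [List.nodup_append] at h2
      simp only [List.mem_append, List.mem_cons, List.not_mem_nil, or_false] at h3 h5
      refine ⟨⟨h2.1, fun a ha => h3 a (Or.inl ha)⟩, ?_, ?_⟩
      · rw [List.nodup_cons]
        exact ⟨fun hm => (h5 b hm).1 (Or.inr rfl), h4⟩
      · intro a ha
        rcases List.mem_cons.1 ha with rfl | ha
        · exact ⟨fun hm => h2.2.2 a hm a (by simp) rfl, Or.inl (h3 a (Or.inr rfl))⟩
        · have := h5 a ha
          exact ⟨fun hm => this.1 (Or.inl hm), by omega⟩

def trunc (T : List ℕ → ℤ) (m : ℕ) : List ℕ → ℤ := fun l => if l.length ≤ m then T l else 0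

def stepT (z : ℕ → ℕ) (T : List ℕ → ℤ) (m : ℕ) : List ℕ → ℤ :=
  fun l => if l.length ≤ m then T l else - FF z (trunc T m) [] l 0

lemma trunc_supp {T : List ℕ → ℤ} {N m : ℕ} (h : Supp T N) : Supp (trunc T m) N := by
  intro l hl
  apply h l
  intro h0
  simp [trunc, h0] at hl

lemma stepT_supp {z : ℕ → ℕ} {T : List ℕ → ℤ} {N m : ℕ} (hz : ∀ i, z i < N) (h : Supp T N) :
    Supp (stepT z T m) N := by
  intro l hl
  unfold stepT at hl
  split_ifs at hl
  · exact h l hl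
  · exact (FF_supp z _ N hz (trunc_supp h) l [] 0 (by simpa using hl)).2

lemma stepT_coh {z : ℕ → ℕ} {T : List ℕ → ℤ} {N m : ℕ} (hz : ∀ i, z i < N)
    (hc : Coh T N m) : Coh (stepT z T m) N (m+1) := by
  intro l₁ l₂ hl
  by_cases hm : l₁.length + l₂.length < m
  · have : l₁.length + (l₂.length + 1) ≤ m := by omega
    have h' : l₁.length + l₂.length ≤ m := by omega
    simp only [stepT, List.length_append, List.length_cons, this, h', if_true]
    exact hc l₁ l₂ hm
  · have : ¬ (l₁.length + (l₂.length + 1) ≤ m) := by omega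
    have h' : l₁.length + l₂.length ≤ m := by omega
    have h'' : l₁.length + l₂.length = m := by omega
    simp only [stepT, List.length_append, List.length_cons, this, h', if_true, if_false]
    rw [Finset.sum_neg_distrib, FF_sum2 z (trunc T m) (fun l => if l.length = m then T l else 0)
      N m hz]
    · simp [h'']
    · intro l hl; simp [hl.ne]
    · intro a b hab
      by_cases hlt : a.length + b.length < m
      · have h1 : a.length + (b.length + 1) ≤ m := by omega
        have h2 : a.length + b.length ≠ m := by omega
        simp only [trunc, List.length_append, List.length_cons, h1, hab, h2, if_true, if_false]
        rw [hc a b hlt]; simp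
      · have h1 : ¬ (a.length + (b.length + 1) ≤ m) := by omega
        have h2 : a.length + b.length = m := by omega
        simp only [trunc, List.length_append, List.length_cons, h1, hab, h2, if_true, if_false]
        simp
    · simp; omega

lemma Coh_mono {T : List ℕ → ℤ} {n N m : ℕ} (hn : n ≤ N) (hs : Supp T n) (hc : Coh T n m) :
    Coh T N m := by
  intro l₁ l₂ hl
  rw [← hc l₁ l₂ hl]
  symm
  apply Finset.sum_subset (Finset.range_mono hn)
  intro a _ ha
  by_contra h
  exact ha (Finset.mem_range.2 (hs _ h a (by simp)))

lemma hollow_exists (k : ℕ) : ∃ T : List ℕ → ℤ, T [] = 1 ∧ Supp T (((k+1)^2 + (k+1))/2) ∧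
    Coh T (((k+1)^2 + (k+1))/2) (k+1) ∧ ∀ l : List ℕ, l.length ≤ k+1 → T l ≠ 0 → l.Nodup := by
  induction k with
  | zero =>
    refine ⟨fun l => if l = [] ∨ l = [0] then 1 else 0, by simp, ?_, ?_, ?_⟩
    · intro l hl
      simp only [ne_eq, ite_eq_right_iff, one_ne_zero, imp_false, not_not] at hl
      rcases hl with rfl | rfl <;> simp
    · intro l₁ l₂ hl
      have h1 : l₁ = [] := List.length_eq_zero_iff.1 (by omega)
      have h2 : l₂ = [] := List.length_eq_zero_iff.1 (by omega)
      subst h1 h2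
      simp
    · intro l _ hl
      simp only [ne_eq, ite_eq_right_iff, one_ne_zero, imp_false, not_not] at hl
      rcases hl with rfl | rfl <;> simp
  | succ k ih =>
    obtain ⟨T, h0, hs, hc, hh⟩ := ih
    have hN : ((k+1+1)^2 + (k+1+1))/2 = ((k+1)^2 + (k+1))/2 + (k+2) := by
      rw [show (k+1+1)^2 + (k+1+1) = ((k+1)^2 + (k+1)) + (k+2)*2 by ring]
      exact Nat.add_mul_div_right _ _ (by norm_num)
    rw [hN]
    set n := ((k+1)^2 + (k+1))/2
    have hz : ∀ i, (fun i => n + min i (k+1)) i < n + (k+2) := by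
      intro i; simp only; omega
    have hs' : Supp T (n + (k+2)) := fun l hl a ha => lt_of_lt_of_le (hs l hl a ha) (by omega)
    refine ⟨stepT (fun i => n + min i (k+1)) T (k+1), by simp [stepT, h0], stepT_supp hz hs',
      stepT_coh hz (Coh_mono (by omega) hs hc), ?_⟩
    intro l hl hne
    unfold stepT at hne
    split_ifs at hne with hle
    · exact hh l hle hne
    · refine (FF_nodup _ (trunc T (k+1)) n (k+1) ?_ (trunc_supp hs) ?_ l [] 0 (by omega)
        (by simpa using hne)).2.1
      · intro i hi; simp [hi]
      · intro l hl
        unfold trunc at hl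
        split_ifs at hl with h
        · exact hh l h hl
        · simp at hl

lemma proj_list {n M : ℕ} (T : List ℕ → ℤ) (hc : Coh T n M) :
    ∀ (q k : ℕ) (i : Fin k → Fin q) (_ : StrictMono i) (a : Fin k → Fin n) (u : List ℕ),
      u.length + q ≤ M →
      (∑ b : Fin q → Fin n, if (fun t => b (i t)) = a then
        T (u ++ List.ofFn (fun j => (b j : ℕ))) else 0) = T (u ++ List.ofFn (fun j => (a j : ℕ))) := by
  intro q
  induction q with
  | zero =>
    intro k i hi a u hu
    cases k with
    | zero => simp [Subsingleton.elim _ a]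
    | succ k => exact (i 0).elim0
  | succ q ih =>
    intro k i hi a u hu
    rw [← (Fin.consEquiv (fun _ => Fin n)).sum_comp, Fintype.sum_prod_type]
    by_cases h0 : ∃ t, i t = 0
    · obtain ⟨t, ht⟩ := h0
      cases k with
      | zero => exact t.elim0
      | succ k =>
        have hi0 : i 0 = 0 := by
          have := hi.monotone (Fin.zero_le t)
          rw [ht] at this
          exact le_antisymm this (Fin.zero_le _)
        have hpos : ∀ s : Fin k, i s.succ ≠ 0 := fun s => by
          have := hi (Fin.succ_pos s)
          rw [hi0] at this
          exact this.ne'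
        have := ih k (fun s => (i s.succ).pred (hpos s)) (by
          intro x y hxy
          exact Fin.pred_lt_pred_iff.2 (hi (Fin.succ_lt_succ_iff.2 hxy))) (fun s => a s.succ)
          (u ++ [(a 0 : ℕ)]) (by simp; omega)
        rw [List.ofFn_succ]
        simp only [List.append_assoc, List.cons_append, List.nil_append] at this
        rw [← this, Finset.sum_eq_single (a 0)]
        · apply Finset.sum_congr rfl
          intro b _
          have hcond : ((fun t => (Fin.consEquiv (fun _ => Fin n)) (a 0, b) (i t)) = a) ↔
              ((fun s => b ((i s.succ).pred (hpos s))) = fun s => a s.succ) := by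
            rw [funext_iff, funext_iff, Fin.forall_fin_succ]
            have e : ∀ s : Fin k, (Fin.cons (a 0) b : Fin (q+1) → Fin n) (i s.succ)
                = b ((i s.succ).pred (hpos s)) := by
              intro s
              conv_lhs => rw [← Fin.succ_pred (i s.succ) (hpos s)]
              rw [Fin.cons_succ]
            simp [Fin.consEquiv, hi0, e]
          simp only [hcond]
          simp [Fin.consEquiv, List.ofFn_succ]
        · intro c _ hca
          apply Finset.sum_eq_zero
          intro b _
          rw [if_neg]
          intro h
          have := congrFun h 0
          simp [Fin.consEquiv, hi0] at this
          exact hca this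
        · simp
    · have hpos : ∀ s, i s ≠ 0 := fun s hs => h0 ⟨s, hs⟩
      have := ih k (fun s => (i s).pred (hpos s)) (by
          intro x y hxy
          exact Fin.pred_lt_pred_iff.2 (hi hxy)) a u (by omega)
      rw [← this, Finset.sum_comm]
      apply Finset.sum_congr rfl
      intro b _
      have e : ∀ (c : Fin n) s, (Fin.cons c b : Fin (q+1) → Fin n) (i s)
          = b ((i s).pred (hpos s)) := by
        intro c s
        conv_lhs => rw [← Fin.succ_pred (i s) (hpos s)]
        rw [Fin.cons_succ]
      have hc' := hc u (List.ofFn (fun j => (b j : ℕ))) (by simp; omega)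
      rw [Finset.sum_range] at hc'
      simp only [Fin.consEquiv, Equiv.coe_fn_mk, e]
      split_ifs
      · rw [← hc']
        simp [List.ofFn_succ]
      · simp

/-- For all `1 ≤ k ≤ q` there is an affine `k`-crystal of dimension `q` and
width `(k² + k)/2` whose `k`-shadow is hollow. -/
theorem stmt_14 (k q : ℕ) (hk : 0 < k) (hkq : k ≤ q) :
    ∃ (C : (Fin q → Fin ((k ^ 2 + k) / 2)) → ℤ)
      (S : (Fin k → Fin ((k ^ 2 + k) / 2)) → ℤ),
      (∑ b, C b) = 1 ∧
      (∀ i : Fin k → Fin q, StrictMono i → cproj C i = S) ∧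
      (∀ a, ¬ Function.Injective a → S a = 0) := by
  have key : ∀ d : ℕ, ∃ T : List ℕ → ℤ, T [] = 1 ∧ Supp T ((k^2 + k)/2) ∧
      Coh T ((k^2 + k)/2) (k + d) ∧ ∀ l : List ℕ, l.length ≤ k → T l ≠ 0 → l.Nodup := by
    intro d
    induction d with
    | zero =>
      obtain ⟨k, rfl⟩ : ∃ j, k = j + 1 := ⟨k - 1, by omega⟩
      exact hollow_exists k
    | succ d ih =>
      obtain ⟨T, h0, hs, hc, hh⟩ := ih
      have hpos : 0 < (k^2 + k)/2 := Nat.div_pos (by nlinarith) (by norm_num)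
      refine ⟨stepT (fun _ => 0) T (k + d), by simp [stepT, h0], stepT_supp (fun _ => hpos) hs,
        stepT_coh (fun _ => hpos) hc, ?_⟩
      intro l hl hne
      rw [stepT, if_pos (by omega)] at hne
      exact hh l hl hne
  obtain ⟨T, h0, hs, hc, hh⟩ := key (q - k)
  rw [Nat.add_sub_cancel' hkq] at hc
  refine ⟨fun b => T (List.ofFn (fun j => (b j : ℕ))), fun a => T (List.ofFn (fun j => (a j : ℕ))),
    ?_, ?_, ?_⟩
  · have := proj_list T hc q 0 Fin.elim0 (fun x => x.elim0) Fin.elim0 [] (by simp)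
    simpa [h0, Subsingleton.elim _ (Fin.elim0 : Fin 0 → Fin ((k^2+k)/2))] using this
  · intro i hi
    funext a
    have := proj_list T hc q k i hi a [] (by simp)
    simpa [cproj] using this
  · intro a ha
    by_contra h
    have := hh _ (by simp) h
    rw [List.nodup_ofFn] at this
    exact ha (fun x y hxy => this (by simp [hxy]))
end
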